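/- Let M_p be a weight sequence satisfying (M.1) and let ω : ℝ^d → (0,∞) be measurable with: for every R > 0 there is C_R > 0 such that ω(x+h) ≤ C_R ω(x) for all x ∈ ℝ^d and |h| ≤ R. Let ψ : ℝ^d → ℂ be smooth with supp ψ ⊆ B̄(0,R) and sup_{α∈ℕ^d} sup_{x} |∂^αψ(x)|/(ℓ'^{|α|}M_α) < ∞ for every ℓ' > 0. Then for every ℓ > 0 there is C > 0 such that for every smooth φ : ℝ^d → ℂ with ‖φ‖_{D^{M_p,ℓ}_{L¹_ω}} < ∞ and every ξ ∈ ℝ^d: ∫_{ℝ^d} |V_ψφ(x,ξ)| ω(x) dx ≤ C ‖φ‖_{D^{M_p,ℓ}_{L¹_ω}} e^{−M(π|ξ|/(ℓ√d))}. -/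

import Mathlib

open MeasureTheory Real
open scoped BigOperators Pointwise

noncomputable section

/-- `ℝ^d` with the Euclidean norm. -/
abbrev Rd (d : ℕ) := EuclideanSpace ℝ (Fin d)

/-- Condition (M.1): a positive, logarithmically convex weight sequence. -/
def IsM1 (M : ℕ → ℝ) : Prop :=
  (∀ p, 0 < M p) ∧ ∀ p : ℕ, 1 ≤ p → (M p) ^ 2 ≤ M (p - 1) * M (p + 1)

/-- Condition (M.2)'. -/
def IsM2' (M : ℕ → ℝ) : Prop :=
  ∃ A H : ℝ, 1 ≤ A ∧ 1 ≤ H ∧ ∀ p : ℕ, M (p + 1) ≤ A * H ^ p * M p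

/-- Condition (M.2). -/
def IsM2 (M : ℕ → ℝ) : Prop :=
  ∃ A H : ℝ, 1 ≤ A ∧ 1 ≤ H ∧ ∀ p q : ℕ, M (p + q) ≤ A * H ^ (p + q) * M p * M q

/-- Condition (M.3)'. -/
def IsM3' (M : ℕ → ℝ) : Prop := Summable fun p : ℕ => M p / M (p + 1)

/-- Condition (M.3). -/
def IsM3 (M : ℕ → ℝ) : Prop :=
  IsM3' M ∧ ∃ c₀ > (0 : ℝ), ∀ q : ℕ, 1 ≤ q →
    (∑' j : ℕ, M (q + j - 1) / M (q + j)) ≤ c₀ * q * (M (q - 1) / M q)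

/-- The associated function `M(t) = sup_p log (t^p M 0 / M p)`, with `M(0) = 0`. -/
def assocFn (M : ℕ → ℝ) (t : ℝ) : ℝ :=
  if t = 0 then 0 else ⨆ p : ℕ, Real.log (t ^ p * M 0 / M p)

variable {d : ℕ}

/-- The partial derivative in the `i`-th coordinate direction. -/
def pder (i : Fin d) (f : Rd d → ℂ) : Rd d → ℂ :=
  fun x => fderiv ℝ f x (EuclideanSpace.single i 1)

/-- The multi-index partial derivative `∂^α`. -/
def mderiv (α : Fin d → ℕ) (f : Rd d → ℂ) : Rd d → ℂ :=
  (List.finRange d).foldr (fun i g => (pder i)^[α i] g) f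

/-- The order `|α|` of a multi-index. -/
def mOrd (α : Fin d → ℕ) : ℕ := ∑ i, α i

/-- The factorial `α!` of a multi-index. -/
def mFact (α : Fin d → ℕ) : ℕ := ∏ i, Nat.factorial (α i)

/-- The set of quotients defining the norm of `E^{M_p,ℓ}(K)`. -/
def ESet (M : ℕ → ℝ) (ℓ : ℝ) (K : Set (Rd d)) (φ : Rd d → ℂ) : Set ℝ :=
  {r | ∃ (α : Fin d → ℕ) (x : Rd d), x ∈ K ∧
    r = ‖mderiv α φ x‖ / (ℓ ^ mOrd α * M (mOrd α))}

/-- `‖φ‖_{E^{M_p,ℓ}(K)}`. -/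
def Enorm (M : ℕ → ℝ) (ℓ : ℝ) (K : Set (Rd d)) (φ : Rd d → ℂ) : ℝ :=
  sSup (ESet M ℓ K φ)

/-- Finiteness of `‖φ‖_{E^{M_p,ℓ}(K)}`. -/
def EnormFin (M : ℕ → ℝ) (ℓ : ℝ) (K : Set (Rd d)) (φ : Rd d → ℂ) : Prop :=
  BddAbove (ESet M ℓ K φ)

/-- Membership in the test space `D^{(M_p)}(ℝ^d)`. -/
def IsTestD (M : ℕ → ℝ) (φ : Rd d → ℂ) : Prop :=
  ContDiff ℝ (⊤ : ℕ∞) φ ∧ HasCompactSupport φ ∧ ∀ ℓ > (0 : ℝ), EnormFin M ℓ (tsupport φ) φ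

/-- `f` is a Beurling ultradistribution of class `(M_p)`. -/
def IsUltraD (M : ℕ → ℝ) (f : (Rd d → ℂ) →ₗ[ℂ] ℂ) : Prop :=
  ∀ K : Set (Rd d), IsCompact K → ∃ ℓ > (0 : ℝ), ∃ C > (0 : ℝ), ∀ φ : Rd d → ℂ,
    IsTestD M φ → tsupport φ ⊆ K → ‖f φ‖ ≤ C * Enorm M ℓ K φ

/-- Euclidean dot product. -/
def dotR (ξ t : Rd d) : ℝ := ∑ i, ξ i * t i

/-- The window `t ↦ conj(ψ(t-x)) e^{-2πi ξ·t}` of the short-time Fourier transform. -/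
def windowFn (ψ : Rd d → ℂ) (x ξ : Rd d) : Rd d → ℂ :=
  fun t => (starRingEnd ℂ) (ψ (t - x)) * Complex.exp (-(2 * Real.pi * dotR ξ t : ℝ) * Complex.I)

/-- The short-time Fourier transform of a function `φ` with respect to the window `ψ`. -/
def STFTf (ψ φ : Rd d → ℂ) (x ξ : Rd d) : ℂ := ∫ t, φ t * windowFn ψ x ξ t

/-- The short-time Fourier transform of a linear functional `f` w.r.t. the window `ψ`. -/
def STFTd (f : (Rd d → ℂ) →ₗ[ℂ] ℂ) (ψ : Rd d → ℂ) (x ξ : Rd d) : ℂ := f (windowFn ψ x ξ)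

/-- The weight condition (5): `ω(·+x)/ω(x)` locally uniformly bounded. -/
def OmegaCond (ω : Rd d → ℝ) : Prop :=
  (∀ x, 0 < ω x) ∧ Measurable ω ∧
    ∀ R > (0 : ℝ), ∃ C > (0 : ℝ), ∀ x h : Rd d, ‖h‖ ≤ R → ω (x + h) ≤ C * ω x

/-- The set of values defining `‖φ‖_{D^{M_p,ℓ}_{L¹_ω}}`. -/
def DL1Set (M : ℕ → ℝ) {d : ℕ} (ω : Rd d → ℝ) (ℓ : ℝ) (φ : Rd d → ℂ) : Set ℝ :=
  {r | ∃ α : Fin d → ℕ, r = (∫ x, ‖mderiv α φ x‖ * ω x) / (ℓ ^ mOrd α * M (mOrd α))}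

/-- `‖φ‖_{D^{M_p,ℓ}_{L¹_ω}}`. -/
def DL1norm (M : ℕ → ℝ) {d : ℕ} (ω : Rd d → ℝ) (ℓ : ℝ) (φ : Rd d → ℂ) : ℝ :=
  sSup (DL1Set M ω ℓ φ)

/-- Finiteness of `‖φ‖_{D^{M_p,ℓ}_{L¹_ω}}`. -/
def DL1Fin (M : ℕ → ℝ) {d : ℕ} (ω : Rd d → ℝ) (ℓ : ℝ) (φ : Rd d → ℂ) : Prop :=
  (∀ α : Fin d → ℕ, Integrable fun x => ‖mderiv α φ x‖ * ω x) ∧ BddAbove (DL1Set M ω ℓ φ)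

theorem foldr_pder_of_forall_eq_zero (l : List (Fin d)) (α : Fin d → ℕ) (f : Rd d → ℂ)
    (h : ∀ i ∈ l, α i = 0) : l.foldr (fun i g => (pder i)^[α i] g) f = f := by
  induction l with
  | nil => rfl
  | cons a l ih =>
    rw [List.foldr_cons, ih fun i hi => h i (List.mem_cons_of_mem _ hi), h a (by simp)]
    rfl

theorem foldr_pder_single (l : List (Fin d)) (hl : l.Nodup) (i : Fin d) (hi : i ∈ l) (p : ℕ)
    (f : Rd d → ℂ) :
    l.foldr (fun j g => (pder j)^[(Pi.single i p : Fin d → ℕ) j] g) f = (pder i)^[p] f := by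
  induction l with
  | nil => simp at hi
  | cons a l ih =>
    rw [List.nodup_cons] at hl
    rw [List.foldr_cons]
    by_cases hai : a = i
    · subst hai
      rw [foldr_pder_of_forall_eq_zero, Pi.single_eq_same]
      intro j hj
      exact Pi.single_eq_of_ne (ne_of_mem_of_not_mem hj hl.1) _
    · rw [ih hl.2 ((List.mem_cons.1 hi).resolve_left (Ne.symm hai)), Pi.single_eq_of_ne hai]
      rfl

theorem mderiv_single (i : Fin d) (p : ℕ) (f : Rd d → ℂ) :
    mderiv (Pi.single i p) f = (pder i)^[p] f :=
  foldr_pder_single _ (List.nodup_finRange d) i (List.mem_finRange i) p f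

theorem mderiv_zero (f : Rd d → ℂ) : mderiv 0 f = f :=
  foldr_pder_of_forall_eq_zero _ _ f fun _ _ => rfl

theorem mOrd_single (i : Fin d) (p : ℕ) : mOrd (Pi.single i p : Fin d → ℕ) = p := by
  simp [mOrd]

theorem mOrd_zero : mOrd (0 : Fin d → ℕ) = 0 := by
  simp [mOrd]

theorem contDiff_pder (i : Fin d) {f : Rd d → ℂ} (hf : ContDiff ℝ (⊤ : ℕ∞) f) :
    ContDiff ℝ (⊤ : ℕ∞) (pder i f) :=
  (hf.fderiv_right (m := (⊤ : ℕ∞)) (by simp)).clm_apply contDiff_const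

theorem contDiff_pder_iterate (i : Fin d) {f : Rd d → ℂ} (hf : ContDiff ℝ (⊤ : ℕ∞) f) (k : ℕ) :
    ContDiff ℝ (⊤ : ℕ∞) ((pder i)^[k] f) := by
  induction k with
  | zero => exact hf
  | succ k ih =>
    rw [Function.iterate_succ_apply']
    exact contDiff_pder i ih

theorem tsupport_pder_iterate_subset (i : Fin d) (f : Rd d → ℂ) (k : ℕ) :
    tsupport ((pder i)^[k] f) ⊆ tsupport f := by
  induction k with
  | zero => exact subset_rfl
  | succ k ih =>
    rw [Function.iterate_succ_apply']
    exact (tsupport_fderiv_apply_subset ℝ _).trans ih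

/-- Under (M.1), `M j * M k ≤ M 0 * M (j + k)`. -/
theorem IsM1.mul_le {M : ℕ → ℝ} (hM : IsM1 M) (j k : ℕ) : M j * M k ≤ M 0 * M (j + k) := by
  obtain ⟨hpos, hlog⟩ := hM
  have hmono : Monotone fun p => M (p + 1) / M p := by
    refine monotone_nat_of_le_succ fun p => ?_
    rw [div_le_div_iff₀ (hpos _) (hpos _)]
    have := hlog (p + 1) (by omega)
    simp only [Nat.add_sub_cancel] at this
    linarith
  have hstep (p : ℕ) : M (p + 1) = M p * (M (p + 1) / M p) := by
    field_simp [(hpos p).ne']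
  induction k with
  | zero => simp [mul_comm]
  | succ k ih =>
    have hr : 0 ≤ M (k + 1) / M k := (div_pos (hpos _) (hpos _)).le
    calc M j * M (k + 1) = M j * M k * (M (k + 1) / M k) := by rw [hstep k]; ring_nf; field_simp
      _ ≤ M 0 * M (j + k) * (M (k + 1) / M k) := by gcongr
      _ ≤ M 0 * M (j + k) * (M (j + k + 1) / M (j + k)) := by
        have := hmono (Nat.le_add_left k j)
        have h0 := (mul_pos (hpos 0) (hpos (j + k))).le
        exact mul_le_mul_of_nonneg_left this h0
      _ = M 0 * M (j + (k + 1)) := by rw [← add_assoc, hstep (j + k)]; ring_nf; field_simp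

/-- Iterating `c * I j k ≤ I (j + 1) k + I j (k + 1)` against a bound depending on `j + k`. -/
theorem pow_mul_le_of_mul_le_add {I : ℕ → ℕ → ℝ} {B : ℕ → ℝ} {c : ℝ} (hc : 0 ≤ c)
    (hB : ∀ j k, I j k ≤ B (j + k)) (hI : ∀ j k, c * I j k ≤ I (j + 1) k + I j (k + 1))
    (p j k : ℕ) : c ^ p * I j k ≤ 2 ^ p * B (j + k + p) := by
  induction p generalizing j k with
  | zero => simpa using hB j k
  | succ p ih =>
    have h1 := ih (j + 1) k
    have h2 := ih j (k + 1)
    rw [show j + 1 + k + p = j + k + (p + 1) by ring] at h1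
    rw [show j + (k + 1) + p = j + k + (p + 1) by ring] at h2
    calc c ^ (p + 1) * I j k = c ^ p * (c * I j k) := by ring
      _ ≤ c ^ p * (I (j + 1) k + I j (k + 1)) := by gcongr; exact hI j k
      _ ≤ 2 ^ (p + 1) * B (j + k + (p + 1)) := by rw [pow_succ (2 : ℝ)]; linarith

theorem contDiff_modulation (ξ : Rd d) :
    ContDiff ℝ (⊤ : ℕ∞) fun t : Rd d =>
      Complex.exp (-(2 * Real.pi * dotR ξ t : ℝ) * Complex.I) := by
  have hdot : ContDiff ℝ (⊤ : ℕ∞) fun t : Rd d => 2 * Real.pi * dotR ξ t := by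
    unfold dotR
    fun_prop
  exact ((Complex.ofRealCLM.contDiff.comp hdot).neg.mul contDiff_const).cexp

theorem norm_modulation (ξ t : Rd d) :
    ‖Complex.exp (-(2 * Real.pi * dotR ξ t : ℝ) * Complex.I)‖ = 1 := by
  rw [← Complex.ofReal_neg, Complex.norm_exp_ofReal_mul_I]

theorem pder_modulation (ξ : Rd d) (i : Fin d) (t : Rd d) :
    fderiv ℝ (fun t : Rd d => Complex.exp (-(2 * Real.pi * dotR ξ t : ℝ) * Complex.I)) t
        (EuclideanSpace.single i 1) =
      -(2 * Real.pi * ξ i * Complex.I) *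
        Complex.exp (-(2 * Real.pi * dotR ξ t : ℝ) * Complex.I) := by
  have hd : DifferentiableAt ℝ
      (fun t : Rd d => Complex.exp (-(2 * Real.pi * dotR ξ t : ℝ) * Complex.I)) t :=
    (contDiff_modulation ξ).differentiable (by simp) t
  rw [← hd.lineDeriv_eq_fderiv]
  refine HasLineDerivAt.lineDeriv ?_
  have hdot (s : ℝ) : dotR ξ (t + s • EuclideanSpace.single i 1) = dotR ξ t + s * ξ i := by
    simp [dotR, mul_add, Finset.sum_add_distrib, mul_comm]
  unfold HasLineDerivAt
  simp only [hdot]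
  have h1 : HasDerivAt (fun s : ℝ => 2 * Real.pi * (dotR ξ t + s * ξ i))
      (2 * Real.pi * (1 * ξ i)) 0 :=
    (((hasDerivAt_id (0 : ℝ)).mul_const (ξ i)).const_add (dotR ξ t)).const_mul _
  have h2 := (h1.ofReal_comp.neg.mul_const Complex.I).cexp
  refine h2.congr_deriv ?_
  simp
  ring

theorem hasCompactSupport_comp_sub {ψ : Rd d → ℂ} (hψ : HasCompactSupport ψ) (x : Rd d) :
    HasCompactSupport fun t => ψ (t - x) :=
  hψ.comp_homeomorph (Homeomorph.subRight x)

theorem integrable_mul_windowFn {φ ψ : Rd d → ℂ} (hφ : Continuous φ) (hψ : Continuous ψ)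
    (hψc : HasCompactSupport ψ) (x ξ : Rd d) :
    Integrable fun t => φ t * windowFn ψ x ξ t := by
  have he := (contDiff_modulation ξ).continuous
  refine Continuous.integrable_of_hasCompactSupport ?_ ?_
  · unfold windowFn
    fun_prop
  · refine HasCompactSupport.mul_left (HasCompactSupport.mul_right ?_)
    exact (hasCompactSupport_comp_sub hψc x).comp_left (g := starRingEnd ℂ) (map_zero _)

/-- Integration by parts for the short-time Fourier transform. -/
theorem STFTf_pder {φ ψ : Rd d → ℂ} (hφ : ContDiff ℝ (⊤ : ℕ∞) φ) (hψ : ContDiff ℝ (⊤ : ℕ∞) ψ)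
    (hψc : HasCompactSupport ψ) (i : Fin d) (x ξ : Rd d) :
    (2 * Real.pi * ξ i * Complex.I) * STFTf ψ φ x ξ =
      STFTf ψ (pder i φ) x ξ + STFTf (pder i ψ) φ x ξ := by
  set e : Rd d → ℂ := fun t => Complex.exp (-(2 * Real.pi * dotR ξ t : ℝ) * Complex.I) with he
  set f : Rd d → ℂ := fun t => φ t * (starRingEnd ℂ) (ψ (t - x)) with hf
  have hφd : Differentiable ℝ φ := hφ.differentiable (by simp)
  have hψd : Differentiable ℝ ψ := hψ.differentiable (by simp)
  have hed : Differentiable ℝ e := (contDiff_modulation ξ).differentiable (by simp)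
  have hconj (t : Rd d) : HasFDerivAt (fun t => (starRingEnd ℂ) (ψ (t - x)))
      ((Complex.conjCLE : ℂ →L[ℝ] ℂ).comp (fderiv ℝ ψ (t - x))) t := by
    have h1 : HasFDerivAt (fun t => ψ (t - x)) (fderiv ℝ ψ (t - x)) t :=
      (hasFDerivAt_comp_sub x).2 (hψd (t - x)).hasFDerivAt
    exact (Complex.conjCLE : ℂ →L[ℝ] ℂ).hasFDerivAt.comp t h1
  have hfd (t : Rd d) : HasFDerivAt f _ t := (hφd t).hasFDerivAt.mul (hconj t)
  have hfder (t : Rd d) : fderiv ℝ f t (EuclideanSpace.single i 1) =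
      pder i φ t * (starRingEnd ℂ) (ψ (t - x)) + φ t * (starRingEnd ℂ) (pder i ψ (t - x)) := by
    rw [(hfd t).fderiv]
    simp [pder, mul_comm, add_comm]
  have hint0 := integrable_mul_windowFn hφ.continuous hψ.continuous hψc x ξ
  have hint1 := integrable_mul_windowFn (contDiff_pder i hφ).continuous hψ.continuous hψc x ξ
  have hint2 := integrable_mul_windowFn hφ.continuous (contDiff_pder i hψ).continuous
    (hψc.fderiv_apply ℝ (EuclideanSpace.single i 1)) x ξ
  have hsplit : (fun t => fderiv ℝ f t (EuclideanSpace.single i 1) * e t) = fun t =>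
      pder i φ t * windowFn ψ x ξ t + φ t * windowFn (pder i ψ) x ξ t := by
    funext t
    rw [hfder]
    simp only [windowFn, he]
    ring
  have hmod : (fun t => f t * fderiv ℝ e t (EuclideanSpace.single i 1)) = fun t =>
      -(2 * Real.pi * ξ i * Complex.I) * (φ t * windowFn ψ x ξ t) := by
    funext t
    rw [he, pder_modulation]
    simp only [windowFn, hf]
    ring
  have hprod : (fun t => f t * e t) = fun t => φ t * windowFn ψ x ξ t := by
    funext t
    simp only [windowFn, hf, he]
    ring
  have key := integral_mul_fderiv_eq_neg_fderiv_mul_of_integrable (μ := volume) (f := f) (g := e)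
    (v := EuclideanSpace.single i (1 : ℝ)) (by rw [hsplit]; exact hint1.add hint2)
    (by rw [hmod]; exact hint0.const_mul _) (by rw [hprod]; exact hint0)
    (fun t _ => (hfd t).differentiableAt) (fun t _ => hed t)
  rw [hsplit, hmod, integral_const_mul, integral_add hint1 hint2] at key
  unfold STFTf
  linear_combination -key

theorem measurable_STFTf {φ ψ : Rd d → ℂ} (hφ : Continuous φ) (hψ : Continuous ψ) (ξ : Rd d) :
    Measurable fun x => STFTf ψ φ x ξ := by
  have he := (contDiff_modulation ξ).continuous
  have hcont : Continuous fun q : Rd d × Rd d => φ q.2 * windowFn ψ q.1 ξ q.2 := by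
    unfold windowFn
    have := he.comp (continuous_snd (X := Rd d))
    simp only [Function.comp_def] at this
    fun_prop
  exact hcont.stronglyMeasurable.integral_prod_right'.measurable

/-- The weighted `L¹` bound for the short-time Fourier transform with a compactly supported
bounded window. -/
theorem integral_norm_STFTf_mul_le {ω : Rd d → ℝ} (hω : ∀ x, 0 < ω x) (hωm : Measurable ω)
    {R C : ℝ} (hωC : ∀ x h : Rd d, ‖h‖ ≤ R → ω (x + h) ≤ C * ω x)
    {φ ψ : Rd d → ℂ} (hφ : Continuous φ) (hφω : Integrable fun x => ‖φ x‖ * ω x)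
    (hψ : Continuous ψ) (hψR : tsupport ψ ⊆ Metric.closedBall 0 R) (hC : 0 ≤ C)
    {B : ℝ} (hψB : ∀ x, ‖ψ x‖ ≤ B) (ξ : Rd d) :
    (Integrable fun x => ‖STFTf ψ φ x ξ‖ * ω x) ∧
      ∫ x, ‖STFTf ψ φ x ξ‖ * ω x ≤
        C * ((∫ x, ‖φ x‖ * ω x) * (B * volume.real (Metric.closedBall (0 : Rd d) R))) := by
  have hψc : HasCompactSupport ψ :=
    (isCompact_closedBall (0 : Rd d) R).of_isClosed_subset (isClosed_tsupport _) hψR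
  have hψz (u : Rd d) (hu : R < ‖u‖) : ψ u = 0 :=
    image_eq_zero_of_notMem_tsupport fun h => by
      have := hψR h
      rw [mem_closedBall_zero_iff] at this
      linarith
  have hψi : Integrable fun u => ‖ψ u‖ := (hψ.integrable_of_hasCompactSupport hψc).norm
  have hψn : Integrable fun u => ‖ψ (-u)‖ := hψi.comp_neg
  have hψint : ∫ u, ‖ψ (-u)‖ ≤ B * volume.real (Metric.closedBall (0 : Rd d) R) := by
    rw [integral_neg_eq_self fun u => ‖ψ u‖,
      ← setIntegral_eq_integral_of_forall_compl_eq_zero (s := Metric.closedBall (0 : Rd d) R)]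
    · refine (Real.le_norm_self _).trans
        (norm_setIntegral_le_of_norm_le_const measure_closedBall_lt_top fun u _ => ?_)
      simpa using hψB u
    · intro u hu
      rw [mem_closedBall_zero_iff, not_le] at hu
      rw [hψz u hu, norm_zero]
  set L := ContinuousLinearMap.mul ℝ ℝ
  have hconv := hφω.integrable_convolution L hψn
  have hconvint := integral_convolution (μ := volume) (ν := volume) L hφω hψn
  have hpt (x : Rd d) : ‖STFTf ψ φ x ξ‖ * ω x ≤
      C * convolution (fun x => ‖φ x‖ * ω x) (fun u => ‖ψ (-u)‖) L volume x := by
    rw [convolution_def, ← integral_const_mul]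
    calc ‖STFTf ψ φ x ξ‖ * ω x ≤ (∫ t, ‖φ t * windowFn ψ x ξ t‖) * ω x := by
          gcongr
          · exact (hω x).le
          · exact norm_integral_le_integral_norm _
      _ = ∫ t, ‖φ t * windowFn ψ x ξ t‖ * ω x := (integral_mul_const _ _).symm
      _ ≤ _ := by
          refine integral_mono_of_nonneg
            (.of_forall fun t => mul_nonneg (norm_nonneg _) (hω x).le) ?_ (.of_forall fun t => ?_)
          · refine Integrable.const_mul ?_ C
            refine hφω.mul_bdd (c := B) ?_ (.of_forall fun t => ?_)
            · exact (by fun_prop : Continuous fun t => ‖ψ (-(x - t))‖).aestronglyMeasurable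
            · simpa using hψB _
          · simp only [windowFn, norm_mul, norm_modulation, L, ContinuousLinearMap.mul_apply',
              RCLike.norm_conj, mul_one, neg_sub]
            by_cases hu : R < ‖t - x‖
            · simp [hψz _ hu]
            · have hle := hωC t (x - t) (by rw [norm_sub_rev]; exact not_lt.1 hu)
              rw [add_sub_cancel] at hle
              calc ‖φ t‖ * ‖ψ (t - x)‖ * ω x ≤ ‖φ t‖ * ‖ψ (t - x)‖ * (C * ω t) := by gcongr
                _ = _ := by ring
  have hint : Integrable fun x => ‖STFTf ψ φ x ξ‖ * ω x := by
    refine (hconv.const_mul C).mono'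
      ((measurable_STFTf hφ hψ ξ).norm.mul hωm).aestronglyMeasurable (.of_forall fun x => ?_)
    rw [Real.norm_of_nonneg (mul_nonneg (norm_nonneg _) (hω x).le)]
    exact hpt x
  refine ⟨hint, (integral_mono hint (hconv.const_mul C) hpt).trans ?_⟩
  rw [integral_const_mul, hconvint]
  have h0 : 0 ≤ ∫ x, ‖φ x‖ * ω x := integral_nonneg fun x => mul_nonneg (norm_nonneg _) (hω x).le
  exact mul_le_mul_of_nonneg_left (mul_le_mul_of_nonneg_left hψint h0) hC

/-- Passing from bounds for all powers to the associated function. -/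
theorem le_mul_exp_neg_assocFn {M : ℕ → ℝ} (hM : ∀ p, 0 < M p) {t I A : ℝ} (ht : 0 ≤ t)
    (hI : 0 ≤ I) (h : ∀ p, t ^ p * M 0 / M p * I ≤ A) : I ≤ A * Real.exp (-assocFn M t) := by
  have h0 : I ≤ A := by simpa [(hM 0).ne'] using h 0
  rcases hI.eq_or_lt with rfl | hI
  · positivity
  rcases ht.eq_or_lt with rfl | ht
  · simpa [assocFn] using h0
  have hA : 0 < A := hI.trans_le h0
  have hle : assocFn M t ≤ Real.log (A / I) := by
    rw [assocFn, if_neg ht.ne']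
    refine ciSup_le fun p => Real.log_le_log ?_ ((le_div_iff₀ hI).2 (h p))
    exact div_pos (mul_pos (pow_pos ht p) (hM 0)) (hM p)
  calc I = A * Real.exp (-Real.log (A / I)) := by
        rw [Real.exp_neg, Real.exp_log (div_pos hA hI)]
        field_simp
    _ ≤ A * Real.exp (-assocFn M t) := by gcongr

theorem exists_norm_le_sqrt_mul_abs (ξ : Rd d) (hd : 0 < d) :
    ∃ i, ‖ξ‖ ≤ Real.sqrt d * |ξ i| := by
  have : Nonempty (Fin d) := ⟨⟨0, hd⟩⟩
  obtain ⟨i, hi⟩ := Finite.exists_max fun i => |ξ i|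
  refine ⟨i, abs_le_of_sq_le_sq' ?_ (by positivity) |>.2⟩
  rw [EuclideanSpace.real_norm_sq_eq, mul_pow, Real.sq_sqrt (Nat.cast_nonneg d), sq_abs]
  calc ∑ j, ξ j ^ 2 ≤ ∑ _j : Fin d, ξ i ^ 2 := Finset.sum_le_sum fun j _ => sq_le_sq.2 (hi j)
    _ = d * ξ i ^ 2 := by simp

/-- `‖V_ψφ(·,ξ)‖_{L¹_ω} ≤ C ‖φ‖_{D^{M_p,ℓ}_{L¹_ω}} e^{-M(π|ξ|/(ℓ√d))}`. -/
theorem stmt4 {d : ℕ} (M : ℕ → ℝ) (hM1 : IsM1 M)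
    (ω : Rd d → ℝ) (hω : OmegaCond ω)
    (ψ : Rd d → ℂ) (R : ℝ) (hψsm : ContDiff ℝ (⊤ : ℕ∞) ψ)
    (hψsupp : tsupport ψ ⊆ Metric.closedBall 0 R)
    (hψb : ∀ ℓ' > (0 : ℝ), EnormFin M ℓ' Set.univ ψ) :
    ∀ ℓ > (0 : ℝ), ∃ C > (0 : ℝ), ∀ φ : Rd d → ℂ, ContDiff ℝ (⊤ : ℕ∞) φ →
      DL1Fin M ω ℓ φ → ∀ ξ : Rd d,
      Integrable (fun x => ‖STFTf ψ φ x ξ‖ * ω x) ∧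
      (∫ x, ‖STFTf ψ φ x ξ‖ * ω x) ≤
        C * DL1norm M ω ℓ φ * Real.exp (-assocFn M (Real.pi * ‖ξ‖ / (ℓ * Real.sqrt d))) := by
  intro ℓ hℓ
  obtain ⟨hωpos, hωm, hωR⟩ := hω
  obtain ⟨C, hC, hωC⟩ := hωR (max R 1) (by positivity)
  obtain ⟨b, hb⟩ := hψb ℓ hℓ
  have hMpos := hM1.1
  have hψR : tsupport ψ ⊆ Metric.closedBall 0 (max R 1) :=
    hψsupp.trans (Metric.closedBall_subset_closedBall (le_max_left _ _))
  set B := max b 1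
  have hB : 0 < B := by positivity
  set v := volume.real (Metric.closedBall (0 : Rd d) (max R 1))
  have hv : 0 ≤ v := measureReal_nonneg
  have hψB (α : Fin d → ℕ) (x : Rd d) : ‖mderiv α ψ x‖ ≤ B * (ℓ ^ mOrd α * M (mOrd α)) := by
    have h := hb ⟨α, x, Set.mem_univ x, rfl⟩
    have hpos := mul_pos (pow_pos hℓ (mOrd α)) (hMpos (mOrd α))
    exact (div_le_iff₀ hpos).1 (h.trans (le_max_left _ _))
  have hK : 0 < C * B * (v + 1) * M 0 := by have := hMpos 0; positivity
  refine ⟨C * B * (v + 1) * M 0 * M 0, mul_pos hK (hMpos 0), fun φ hφ hfin ξ => ?_⟩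
  obtain ⟨hφint, hφbdd⟩ := hfin
  set N := DL1norm M ω ℓ φ
  have hφN (α : Fin d → ℕ) : ∫ x, ‖mderiv α φ x‖ * ω x ≤ N * (ℓ ^ mOrd α * M (mOrd α)) :=
    (div_le_iff₀ (mul_pos (pow_pos hℓ _) (hMpos _))).1 (le_csSup hφbdd ⟨α, rfl⟩)
  have hnonneg (f g : Rd d → ℂ) : 0 ≤ ∫ x, ‖STFTf f g x ξ‖ * ω x :=
    integral_nonneg fun x => mul_nonneg (norm_nonneg _) (hωpos x).le
  have hN : 0 ≤ N := by
    have h := hφN 0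
    have h0 : 0 ≤ ∫ x, ‖mderiv 0 φ x‖ * ω x :=
      integral_nonneg fun x => mul_nonneg (norm_nonneg _) (hωpos x).le
    exact nonneg_of_mul_nonneg_left (h0.trans h) (mul_pos (pow_pos hℓ _) (hMpos _))
  -- the bound for a pair of derivatives
  have hpair (α β : Fin d → ℕ) (hα : Continuous (mderiv α φ)) (hβ : Continuous (mderiv β ψ))
      (hβR : tsupport (mderiv β ψ) ⊆ Metric.closedBall 0 (max R 1)) :
      (Integrable fun x => ‖STFTf (mderiv β ψ) (mderiv α φ) x ξ‖ * ω x) ∧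
      ∫ x, ‖STFTf (mderiv β ψ) (mderiv α φ) x ξ‖ * ω x ≤
        C * B * (v + 1) * M 0 * N * (ℓ ^ (mOrd α + mOrd β) * M (mOrd α + mOrd β)) := by
    obtain ⟨h1, h2⟩ := integral_norm_STFTf_mul_le hωpos hωm hωC hα (hφint α) hβ hβR hC.le
      (hψB β) ξ
    refine ⟨h1, h2.trans ?_⟩
    have hMα := hMpos (mOrd α)
    have hMβ := hMpos (mOrd β)
    calc C * ((∫ x, ‖mderiv α φ x‖ * ω x) * (B * (ℓ ^ mOrd β * M (mOrd β)) * v))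
        ≤ C * (N * (ℓ ^ mOrd α * M (mOrd α)) * (B * (ℓ ^ mOrd β * M (mOrd β)) * (v + 1))) := by
          gcongr
          · exact hφN α
          · linarith
      _ = C * B * (v + 1) * N * ℓ ^ (mOrd α + mOrd β) * (M (mOrd α) * M (mOrd β)) := by ring
      _ ≤ C * B * (v + 1) * N * ℓ ^ (mOrd α + mOrd β) * (M 0 * M (mOrd α + mOrd β)) := by
          exact mul_le_mul_of_nonneg_left (hM1.mul_le _ _) (by positivity)
      _ = _ := by ring
  have hbase := hpair 0 0 (by rw [mderiv_zero]; exact hφ.continuous)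
    (by rw [mderiv_zero]; exact hψsm.continuous) (by rwa [mderiv_zero])
  simp only [mderiv_zero, mOrd_zero, add_zero, pow_zero, one_mul] at hbase
  refine ⟨hbase.1, ?_⟩
  have ht : 0 ≤ Real.pi * ‖ξ‖ / (ℓ * Real.sqrt d) := by positivity
  refine le_mul_exp_neg_assocFn hMpos ht (hnonneg ψ φ) fun p => ?_
  suffices h : (Real.pi * ‖ξ‖ / (ℓ * Real.sqrt d)) ^ p * ∫ x, ‖STFTf ψ φ x ξ‖ * ω x ≤
      C * B * (v + 1) * M 0 * N * M p by
    have hMp := hMpos p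
    calc (Real.pi * ‖ξ‖ / (ℓ * Real.sqrt d)) ^ p * M 0 / M p * ∫ x, ‖STFTf ψ φ x ξ‖ * ω x
        = (Real.pi * ‖ξ‖ / (ℓ * Real.sqrt d)) ^ p * (∫ x, ‖STFTf ψ φ x ξ‖ * ω x)
            * (M 0 / M p) := by ring
      _ ≤ C * B * (v + 1) * M 0 * N * M p * (M 0 / M p) :=
          mul_le_mul_of_nonneg_right h (div_pos (hMpos 0) hMp).le
      _ = _ := by field_simp
  rcases Nat.eq_zero_or_pos d with hd | hd
  · have hMp := hMpos p
    rcases Nat.eq_zero_or_pos p with rfl | hp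
    · simpa using hbase.2
    · have hz : Real.pi * ‖ξ‖ / (ℓ * Real.sqrt d) = 0 := by simp [hd]
      rw [hz, zero_pow hp.ne', zero_mul]
      positivity
  obtain ⟨i, hi⟩ := exists_norm_le_sqrt_mul_abs ξ hd
  set ψk : ℕ → Rd d → ℂ := fun k => (pder i)^[k] ψ
  set φj : ℕ → Rd d → ℂ := fun j => (pder i)^[j] φ
  have hψk (k : ℕ) : ContDiff ℝ (⊤ : ℕ∞) (ψk k) := contDiff_pder_iterate i hψsm k
  have hφj (j : ℕ) : ContDiff ℝ (⊤ : ℕ∞) (φj j) := contDiff_pder_iterate i hφ j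
  have hψkR (k : ℕ) : tsupport (ψk k) ⊆ Metric.closedBall 0 (max R 1) :=
    (tsupport_pder_iterate_subset i ψ k).trans hψR
  have hψkc (k : ℕ) : HasCompactSupport (ψk k) :=
    (isCompact_closedBall (0 : Rd d) _).of_isClosed_subset (isClosed_tsupport _) (hψkR k)
  have hjk (j k : ℕ) := hpair (Pi.single i j) (Pi.single i k)
    (by rw [mderiv_single]; exact (hφj j).continuous)
    (by rw [mderiv_single]; exact (hψk k).continuous) (by rw [mderiv_single]; exact hψkR k)
  simp only [mderiv_single, mOrd_single] at hjk
  have hstep (j k : ℕ) : 2 * Real.pi * |ξ i| * ∫ x, ‖STFTf (ψk k) (φj j) x ξ‖ * ω x ≤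
      (∫ x, ‖STFTf (ψk k) (φj (j + 1)) x ξ‖ * ω x) +
        ∫ x, ‖STFTf (ψk (k + 1)) (φj j) x ξ‖ * ω x := by
    rw [← integral_const_mul, ← integral_add (hjk (j + 1) k).1 (hjk j (k + 1)).1]
    refine integral_mono ((hjk j k).1.const_mul _)
      ((hjk (j + 1) k).1.add (hjk j (k + 1)).1) fun x => ?_
    have h := congrArg norm (STFTf_pder (hφj j) (hψk k) (hψkc k) i x ξ)
    have hnorm : ‖(2 * Real.pi * ξ i * Complex.I : ℂ)‖ = 2 * Real.pi * |ξ i| := by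
      simp [abs_of_pos Real.pi_pos]
    rw [norm_mul, hnorm] at h
    have hle := h.le.trans (norm_add_le _ _)
    have hφs : φj (j + 1) = pder i (φj j) := Function.iterate_succ_apply' _ _ _
    have hψs : ψk (k + 1) = pder i (ψk k) := Function.iterate_succ_apply' _ _ _
    rw [← hφs, ← hψs] at hle
    calc 2 * Real.pi * |ξ i| * (‖STFTf (ψk k) (φj j) x ξ‖ * ω x)
        = 2 * Real.pi * |ξ i| * ‖STFTf (ψk k) (φj j) x ξ‖ * ω x := by ring
      _ ≤ (‖STFTf (ψk k) (φj (j + 1)) x ξ‖ + ‖STFTf (ψk (k + 1)) (φj j) x ξ‖) * ω x :=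
          mul_le_mul_of_nonneg_right hle (hωpos x).le
      _ = _ := add_mul _ _ _
  have hpow := pow_mul_le_of_mul_le_add
    (I := fun j k => ∫ x, ‖STFTf (ψk k) (φj j) x ξ‖ * ω x)
    (B := fun n => C * B * (v + 1) * M 0 * N * (ℓ ^ n * M n))
    (by positivity : 0 ≤ 2 * Real.pi * |ξ i|) (fun j k => (hjk j k).2) hstep p 0 0
  simp only [zero_add] at hpow
  change (2 * Real.pi * |ξ i|) ^ p * (∫ x, ‖STFTf ψ φ x ξ‖ * ω x) ≤ _ at hpow
  have hcoord : Real.pi * ‖ξ‖ / (ℓ * Real.sqrt d) ≤ Real.pi * |ξ i| / ℓ := by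
    have hsd : 0 < Real.sqrt d := Real.sqrt_pos.2 (by exact_mod_cast hd)
    rw [div_le_div_iff₀ (by positivity) hℓ]
    calc Real.pi * ‖ξ‖ * ℓ ≤ Real.pi * (Real.sqrt d * |ξ i|) * ℓ := by gcongr
      _ = _ := by ring
  have h0 := hnonneg ψ φ
  calc (Real.pi * ‖ξ‖ / (ℓ * Real.sqrt d)) ^ p * ∫ x, ‖STFTf ψ φ x ξ‖ * ω x
      ≤ (Real.pi * |ξ i| / ℓ) ^ p * ∫ x, ‖STFTf ψ φ x ξ‖ * ω x := by gcongr
    _ = (2 * Real.pi * |ξ i|) ^ p * (∫ x, ‖STFTf ψ φ x ξ‖ * ω x) / (2 ^ p * ℓ ^ p) := by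
        rw [div_pow, mul_assoc 2, mul_pow 2]
        field_simp
    _ ≤ 2 ^ p * (C * B * (v + 1) * M 0 * N * (ℓ ^ p * M p)) / (2 ^ p * ℓ ^ p) := by gcongr
    _ = _ := by field_simp
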